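/- Assume (A) for every optimal solution (V^1,...,V^q̂) of SDPR(δ), at least m−1 of the q̂+m quantities V^1,...,V^q̂ (matrices) and δ_k − Σ_q ⟨C^q_k, V^q⟩ (1 ≤ k ≤ m) (real residuals) are nonzero, and (B) SDPR(δ) has an optimal solution. Then SDPR(δ) admits an optimal solution (Ṽ^1,...,Ṽ^q̂) with rank(Ṽ^q) ≤ 1 for all q = 1,...,q̂; consequently, writing Ṽ^q = v̄^q (v̄^q)^T for some v̄^q ∈ ℝ^{n̄^q}, the tuple (v̄^1,...,v̄^q̂) is an optimal solution of the separable homogeneous QCQP(δ), and in particular the SDP relaxation is exact. -/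

import Mathlib

open Matrix BigOperators

noncomputable section

/-- Trace inner product `⟨A,X⟩ = Σᵢⱼ Aᵢⱼ Xᵢⱼ`. -/
def mInner {N : ℕ} (A X : Matrix (Fin N) (Fin N) ℝ) : ℝ :=
  ∑ i, ∑ j, A i j * X i j

/-- The quadratic function `u ↦ (u,1)ᵀ B (u,1)` on `ℝⁿ`. -/
def quadF {n : ℕ} (B : Matrix (Fin (n + 1)) (Fin (n + 1)) ℝ) (u : Fin n → ℝ) : ℝ :=
  Fin.snoc u 1 ⬝ᵥ (B *ᵥ Fin.snoc u 1)

/-- A relation on `ℝ` is standard if it is `≤`, `=`, or `≥`. -/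
def IsStdRel (r : ℝ → ℝ → Prop) : Prop :=
  r = (· ≤ ·) ∨ r = (· = ·) ∨ r = (· ≥ ·)

section Homogeneous

variable (qhat m : ℕ) (nb : Fin qhat → ℕ)
  (C : (q : Fin qhat) → Fin (m + 1) → Matrix (Fin (nb q)) (Fin (nb q)) ℝ)
  (rel : Fin m → ℝ → ℝ → Prop)

/-- Feasibility of `v = (v¹,…,v^q̂)` for the separable homogeneous QCQP(δ). -/
def homQCQPFeas (δ : Fin m → ℝ) (v : (q : Fin qhat) → Fin (nb q) → ℝ) : Prop :=
  ∀ k : Fin m, rel k (∑ q, v q ⬝ᵥ (C q k.succ *ᵥ v q)) (δ k)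

/-- The optimal value `ζ(δ)` of the separable homogeneous QCQP. -/
def homQCQPVal (δ : Fin m → ℝ) : EReal :=
  sInf {y : EReal | ∃ v : (q : Fin qhat) → Fin (nb q) → ℝ,
    homQCQPFeas qhat m nb C rel δ v ∧
    y = ((∑ q, v q ⬝ᵥ (C q 0 *ᵥ v q) : ℝ) : EReal)}

/-- Feasibility of `V = (V¹,…,V^q̂)` for SDPR(δ). -/
def homSDPRFeas (δ : Fin m → ℝ)
    (V : (q : Fin qhat) → Matrix (Fin (nb q)) (Fin (nb q)) ℝ) : Prop :=
  (∀ q, (V q).PosSemidef) ∧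
    ∀ k : Fin m, rel k (∑ q, mInner (C q k.succ) (V q)) (δ k)

/-- The optimal value `η(δ)` of SDPR(δ). -/
def homSDPRVal (δ : Fin m → ℝ) : EReal :=
  sInf {y : EReal | ∃ V : (q : Fin qhat) → Matrix (Fin (nb q)) (Fin (nb q)) ℝ,
    homSDPRFeas qhat m nb C rel δ V ∧
    y = ((∑ q, mInner (C q 0) (V q) : ℝ) : EReal)}

/-- `V` is an optimal solution of SDPR(δ): feasible and attaining the infimum. -/
def homSDPROpt (δ : Fin m → ℝ)
    (V : (q : Fin qhat) → Matrix (Fin (nb q)) (Fin (nb q)) ℝ) : Prop :=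
  homSDPRFeas qhat m nb C rel δ V ∧
    ((∑ q, mInner (C q 0) (V q) : ℝ) : EReal) = homSDPRVal qhat m nb C rel δ

end Homogeneous

lemma isSymm_vecMulVec_self {n : ℕ} (x : Fin n → ℝ) : (vecMulVec x x).IsSymm :=
  transpose_vecMulVec x x

lemma isSymm_vecMulVec_add {n : ℕ} (x y : Fin n → ℝ) :
    (vecMulVec x y + vecMulVec y x).IsSymm := by
  rw [Matrix.IsSymm, transpose_add, transpose_vecMulVec, transpose_vecMulVec, add_comm]

lemma dotProduct_vecMulVec_mulVec {n : ℕ} (x y z : Fin n → ℝ) :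
    z ⬝ᵥ (vecMulVec x y *ᵥ z) = (x ⬝ᵥ z) * (y ⬝ᵥ z) := by
  rw [vecMulVec_mulVec, dotProduct_comm z]
  simp [mul_comm]

lemma posSemidef_iff_isSymm {n : ℕ} {M : Matrix (Fin n) (Fin n) ℝ} :
    M.PosSemidef ↔ M.IsSymm ∧ ∀ z, 0 ≤ z ⬝ᵥ (M *ᵥ z) := by
  rw [posSemidef_iff_dotProduct_mulVec]
  simp [Matrix.IsHermitian, Matrix.IsSymm]

/-- A real positive semidefinite matrix is either of the form `b bᵀ`, or it dominates
`x xᵀ + y yᵀ` for some linearly independent `x` and `y`. -/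
lemma Matrix.PosSemidef.eq_vecMulVec_or_exists_linearIndependent {n : ℕ}
    {M : Matrix (Fin n) (Fin n) ℝ} (hM : M.PosSemidef) :
    (∃ b, M = vecMulVec b b) ∨
      ∃ x y : Fin n → ℝ, LinearIndependent ℝ ![x, y] ∧
        ∀ z, (x ⬝ᵥ z) ^ 2 + (y ⬝ᵥ z) ^ 2 ≤ z ⬝ᵥ (M *ᵥ z) := by
  obtain ⟨N, v, hv⟩ := posSemidef_iff_eq_sum_vecMulVec.mp hM
  simp only [star_trivial] at hv
  by_cases h : ∃ i j, LinearIndependent ℝ ![v i, v j]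
  · obtain ⟨i, j, hij⟩ := h
    have hne : i ≠ j := by
      rintro rfl
      have := LinearIndependent.pair_iff.mp hij 1 (-1) (by simp)
      norm_num at this
    refine Or.inr ⟨v i, v j, hij, fun z => ?_⟩
    have hq : z ⬝ᵥ (M *ᵥ z) = ∑ k, (v k ⬝ᵥ z) ^ 2 := by
      rw [hv, sum_mulVec, dotProduct_sum]
      exact Finset.sum_congr rfl fun k _ => by rw [dotProduct_vecMulVec_mulVec, sq]
    rw [hq, ← Finset.sum_pair (f := fun k => (v k ⬝ᵥ z) ^ 2) hne]
    exact Finset.sum_le_sum_of_subset_of_nonneg (Finset.subset_univ _)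
      fun _ _ _ => sq_nonneg _
  · left
    push Not at h
    by_cases h0 : ∃ i, v i ≠ 0
    · obtain ⟨i, hi⟩ := h0
      have hc : ∀ j, ∃ c : ℝ, c • v i = v j := fun j => by
        have := h i j
        rw [LinearIndependent.pair_iff' hi] at this
        push Not at this
        exact this
      choose c hc using hc
      refine ⟨√(∑ j, c j ^ 2) • v i, ?_⟩
      have hs : 0 ≤ ∑ j, c j ^ 2 := Finset.sum_nonneg fun _ _ => sq_nonneg _
      rw [hv, smul_vecMulVec, vecMulVec_smul, smul_smul, Real.mul_self_sqrt hs, Finset.sum_smul]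
      exact Finset.sum_congr rfl fun j _ => by
        rw [← hc j, smul_vecMulVec, vecMulVec_smul, smul_smul, sq]
    · push Not at h0
      exact ⟨0, by simp [hv, h0]⟩

lemma Matrix.PosSemidef.abs_apply_le_trace {n : ℕ} {M : Matrix (Fin n) (Fin n) ℝ}
    (hM : M.PosSemidef) (i j : Fin n) : |M i j| ≤ M.trace := by
  have hd : ∀ k, M k k ≤ M.trace := fun k =>
    Finset.single_le_sum (f := fun k => M k k) (fun k _ => hM.diag_nonneg) (Finset.mem_univ k)
  have hs := (posSemidef_iff_isSymm.mp hM).1.apply i j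
  have h1 := (posSemidef_iff_isSymm.mp hM).2 (Pi.single i 1 + Pi.single j 1)
  have h2 := (posSemidef_iff_isSymm.mp hM).2 (Pi.single i 1 - Pi.single j 1)
  simp [mulVec_add, mulVec_sub] at h1 h2
  rw [abs_le]
  constructor <;> linarith [hd i, hd j]

lemma isClosed_setOf_posSemidef (n : ℕ) :
    IsClosed {M : Matrix (Fin n) (Fin n) ℝ | M.PosSemidef} := by
  simp only [posSemidef_iff_isSymm, Matrix.IsSymm, Set.ofPred_and, Set.ofPred_forall]
  refine (isClosed_eq (by fun_prop) continuous_id).inter (isClosed_iInter fun z => ?_)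
  exact isClosed_le continuous_const (by fun_prop)

lemma continuous_mInner {N : ℕ} (A : Matrix (Fin N) (Fin N) ℝ) : Continuous (mInner A) := by
  unfold mInner
  fun_prop

lemma mInner_add {N : ℕ} (A X Y : Matrix (Fin N) (Fin N) ℝ) :
    mInner A (X + Y) = mInner A X + mInner A Y := by
  simp [mInner, mul_add, Finset.sum_add_distrib]

lemma mInner_smul {N : ℕ} (A X : Matrix (Fin N) (Fin N) ℝ) (t : ℝ) :
    mInner A (t • X) = t * mInner A X := by
  simp [mInner, Finset.mul_sum, mul_left_comm]

lemma mInner_vecMulVec {N : ℕ} (A : Matrix (Fin N) (Fin N) ℝ) (v : Fin N → ℝ) :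
    mInner A (vecMulVec v v) = v ⬝ᵥ (A *ᵥ v) := by
  simp only [mInner, dotProduct, mulVec, vecMulVec_apply, Finset.mul_sum]
  exact Finset.sum_congr rfl fun i _ => Finset.sum_congr rfl fun j _ => by ring

lemma mInner_self_pos {N : ℕ} {X : Matrix (Fin N) (Fin N) ℝ} (hX : X ≠ 0) :
    0 < mInner X X := by
  have h : 0 ≤ mInner X X :=
    Finset.sum_nonneg fun i _ => Finset.sum_nonneg fun j _ => mul_self_nonneg _
  refine h.lt_of_ne fun h0 => hX ?_
  ext i j
  have h1 := (Finset.sum_eq_zero_iff_of_nonneg fun i _ =>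
    Finset.sum_nonneg fun j _ => mul_self_nonneg (X i j)).mp h0.symm i (Finset.mem_univ i)
  have h2 := (Finset.sum_eq_zero_iff_of_nonneg fun j _ =>
    mul_self_nonneg (X i j)).mp h1 j (Finset.mem_univ j)
  simpa using h2

lemma mInner_one {N : ℕ} (X : Matrix (Fin N) (Fin N) ℝ) : mInner 1 X = X.trace := by
  simp [mInner, Matrix.one_apply, Matrix.trace]

lemma mInner_comm {N : ℕ} (X Y : Matrix (Fin N) (Fin N) ℝ) : mInner X Y = mInner Y X := by
  simp [mInner, mul_comm]

/-- The inner product of two families of square matrices, summed over the blocks. -/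
def blockInner {qhat : ℕ} {nb : Fin qhat → ℕ}
    (A X : (q : Fin qhat) → Matrix (Fin (nb q)) (Fin (nb q)) ℝ) : ℝ :=
  ∑ q, mInner (A q) (X q)

section BlockInner

variable {qhat : ℕ} {nb : Fin qhat → ℕ}

lemma blockInner_add (A X Y : (q : Fin qhat) → Matrix (Fin (nb q)) (Fin (nb q)) ℝ) :
    blockInner A (X + Y) = blockInner A X + blockInner A Y := by
  simp [blockInner, mInner_add, Finset.sum_add_distrib]

lemma blockInner_smul (A X : (q : Fin qhat) → Matrix (Fin (nb q)) (Fin (nb q)) ℝ) (t : ℝ) :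
    blockInner A (t • X) = t * blockInner A X := by
  simp [blockInner, mInner_smul, Finset.mul_sum]

lemma blockInner_comm (A X : (q : Fin qhat) → Matrix (Fin (nb q)) (Fin (nb q)) ℝ) :
    blockInner A X = blockInner X A := by
  simp [blockInner, mInner_comm]

lemma blockInner_self_pos {X : (q : Fin qhat) → Matrix (Fin (nb q)) (Fin (nb q)) ℝ}
    (hX : X ≠ 0) : 0 < blockInner X X := by
  obtain ⟨q, hq⟩ := Function.ne_iff.mp hX
  refine Finset.sum_pos' (fun p _ => ?_) ⟨q, Finset.mem_univ q, mInner_self_pos hq⟩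
  exact Finset.sum_nonneg fun i _ => Finset.sum_nonneg fun j _ => mul_self_nonneg _

lemma continuous_blockInner (A : (q : Fin qhat) → Matrix (Fin (nb q)) (Fin (nb q)) ℝ) :
    Continuous (blockInner A) :=
  continuous_finsetSum _ fun q _ => (continuous_mInner (A q)).comp (continuous_apply q)

lemma blockInner_add_smul_self (X Y : (q : Fin qhat) → Matrix (Fin (nb q)) (Fin (nb q)) ℝ)
    (t : ℝ) : blockInner (X + t • Y) (X + t • Y) =
      blockInner X X + 2 * t * blockInner X Y + t ^ 2 * blockInner Y Y := by
  rw [blockInner_add, blockInner_smul, blockInner_comm _ X, blockInner_comm _ Y, blockInner_add,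
    blockInner_add, blockInner_smul, blockInner_smul, blockInner_comm Y X]
  ring

lemma trace_le_blockInner_one {X : (q : Fin qhat) → Matrix (Fin (nb q)) (Fin (nb q)) ℝ}
    (hX : ∀ q, (X q).PosSemidef) (q : Fin qhat) : (X q).trace ≤ blockInner 1 X := by
  simp only [blockInner, Pi.one_apply, mInner_one]
  exact Finset.single_le_sum (f := fun p => (X p).trace) (fun p _ => (hX p).trace_nonneg)
    (Finset.mem_univ q)

lemma isClosed_setOf_forall_posSemidef :
    IsClosed {X : (q : Fin qhat) → Matrix (Fin (nb q)) (Fin (nb q)) ℝ |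
      ∀ q, (X q).PosSemidef} := by
  rw [Set.ofPred_forall]
  have hproj (q : Fin qhat) :
      Continuous fun X : (p : Fin qhat) → Matrix (Fin (nb p)) (Fin (nb p)) ℝ => X q :=
    continuous_apply q
  exact isClosed_iInter fun q => (isClosed_setOf_posSemidef (nb q)).preimage (hproj q)

/-- The positive semidefinite families of bounded total trace form a compact set. -/
lemma isCompact_posSemidef_blockInner_one_le (T : ℝ) :
    IsCompact {X : (q : Fin qhat) → Matrix (Fin (nb q)) (Fin (nb q)) ℝ |
      (∀ q, (X q).PosSemidef) ∧ blockInner 1 X ≤ T} := by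
  have hbox : IsCompact (Set.univ.pi fun q : Fin qhat =>
      (Set.univ.pi fun _ => Set.univ.pi fun _ => Set.Icc (-T) T :
        Set (Matrix (Fin (nb q)) (Fin (nb q)) ℝ))) :=
    isCompact_univ_pi fun q => isCompact_univ_pi fun _ => isCompact_univ_pi fun _ => isCompact_Icc
  refine hbox.of_isClosed_subset ?_ ?_
  · exact isClosed_setOf_forall_posSemidef.inter
      (isClosed_le (continuous_blockInner 1) continuous_const)
  · rintro X ⟨hX, hT⟩ q - i - j -
    refine Set.mem_Icc.mpr (abs_le.mp (((hX q).abs_apply_le_trace i j).trans ?_))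
    exact (trace_le_blockInner_one hX q).trans hT

/-- A nonempty closed set `F` of positive semidefinite families has a point `V` that is not the
midpoint of a nondegenerate segment in `F`. -/
lemma exists_mem_forall_add_sub_mem_eq_zero
    {F : Set ((q : Fin qhat) → Matrix (Fin (nb q)) (Fin (nb q)) ℝ)} (hF : IsClosed F)
    (hpsd : ∀ X ∈ F, ∀ q, (X q).PosSemidef) (hne : F.Nonempty) :
    ∃ V ∈ F, ∀ D, V + D ∈ F → V - D ∈ F → D = 0 := by
  obtain ⟨V₀, hV₀⟩ := hne
  have hK : IsCompact (F ∩ {X | (∀ q, (X q).PosSemidef) ∧ blockInner 1 X ≤ blockInner 1 V₀}) :=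
    (isCompact_posSemidef_blockInner_one_le _).inter_left hF
  obtain ⟨V₁, ⟨hV₁F, -, hV₁T⟩, hmin⟩ := hK.exists_isMinOn ⟨V₀, hV₀, hpsd V₀ hV₀, le_rfl⟩
    (continuous_blockInner 1).continuousOn
  have hmin' : ∀ X ∈ F, blockInner 1 V₁ ≤ blockInner 1 X := fun X hX => by
    rcases le_total (blockInner 1 X) (blockInner 1 V₀) with h | h
    · exact hmin ⟨hX, hpsd X hX, h⟩
    · exact hV₁T.trans h
  have hK₁ : IsCompact (F ∩ {X | (∀ q, (X q).PosSemidef) ∧ blockInner 1 X ≤ blockInner 1 V₁}) :=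
    (isCompact_posSemidef_blockInner_one_le _).inter_left hF
  have hcont : Continuous fun X : (q : Fin qhat) → Matrix (Fin (nb q)) (Fin (nb q)) ℝ =>
      blockInner X X := by
    unfold blockInner mInner
    fun_prop
  obtain ⟨V, ⟨hVF, -, hVT⟩, hmax⟩ := hK₁.exists_isMaxOn ⟨V₁, hV₁F, hpsd V₁ hV₁F, le_rfl⟩
    hcont.continuousOn
  refine ⟨V, hVF, fun D hp hm => ?_⟩
  have hneg : V - D = V + (-1 : ℝ) • D := by simp [sub_eq_add_neg]
  have h1 := hmin' _ hp
  have h2 := hmin' _ hm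
  have h3 := hmin' _ hVF
  rw [hneg, blockInner_add, blockInner_smul] at h2
  rw [blockInner_add] at h1
  have h4 : blockInner (V + D) (V + D) ≤ blockInner V V :=
    hmax ⟨hp, hpsd _ hp, by rw [blockInner_add]; linarith⟩
  have h5 : blockInner (V - D) (V - D) ≤ blockInner V V :=
    hmax ⟨hm, hpsd _ hm, by rw [hneg, blockInner_add, blockInner_smul]; linarith⟩
  by_contra hD
  have h6 := blockInner_self_pos hD
  have h7 := blockInner_add_smul_self V D 1
  rw [one_smul] at h7
  rw [hneg, blockInner_add_smul_self] at h5
  linarith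

end BlockInner

/-- If `V` dominates `x xᵀ + y yᵀ`, then small perturbations of `V` in the span of `x xᵀ`, `y yᵀ`
and `x yᵀ + y xᵀ` remain positive semidefinite. -/
lemma Matrix.PosSemidef.eventually_add_smul {n : ℕ} {V : Matrix (Fin n) (Fin n) ℝ}
    (hV : V.PosSemidef) {x y : Fin n → ℝ}
    (hxy : ∀ z, (x ⬝ᵥ z) ^ 2 + (y ⬝ᵥ z) ^ 2 ≤ z ⬝ᵥ (V *ᵥ z)) (a b c : ℝ) :
    ∀ᶠ t : ℝ in nhds 0, (V + t • (a • vecMulVec x x + b • vecMulVec y y +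
      c • (vecMulVec x y + vecMulVec y x))).PosSemidef := by
  have hsmall : ∀ d : ℝ, ∀ᶠ t : ℝ in nhds 0, |t * d| < 1 / 2 := fun d => by
    have : Filter.Tendsto (fun t : ℝ => |t * d|) (nhds 0) (nhds |0 * d|) :=
      Continuous.tendsto (by fun_prop) 0
    exact this.eventually (gt_mem_nhds (by simp))
  filter_upwards [hsmall a, hsmall b, hsmall c] with t ha hb hc
  rw [posSemidef_iff_isSymm]
  refine ⟨(posSemidef_iff_isSymm.mp hV).1.add (IsSymm.smul (((isSymm_vecMulVec_self x).smul a).add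
    ((isSymm_vecMulVec_self y).smul b) |>.add ((isSymm_vecMulVec_add x y).smul c)) t), fun z => ?_⟩
  have h := hxy z
  simp only [add_mulVec, smul_mulVec, dotProduct_add, dotProduct_smul,
    dotProduct_vecMulVec_mulVec, smul_eq_mul]
  generalize x ⬝ᵥ z = p at *
  generalize y ⬝ᵥ z = r at *
  rw [abs_lt] at ha hb hc
  have e1 : -(1 / 2) * p ^ 2 ≤ t * a * p ^ 2 := by gcongr; linarith
  have e2 : -(1 / 2) * r ^ 2 ≤ t * b * r ^ 2 := by gcongr; linarith
  have e3 : -(1 / 2) * (p ^ 2 + r ^ 2) ≤ t * c * (2 * (p * r)) := by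
    nlinarith [mul_nonneg (by linarith : 0 ≤ 1 / 2 + t * c) (sq_nonneg (p + r)),
      mul_nonneg (by linarith : 0 ≤ 1 / 2 - t * c) (sq_nonneg (p - r))]
  linarith

lemma eq_zero_of_smul_vecMulVec_add_eq_zero {n : ℕ} {x y : Fin n → ℝ}
    (hxy : LinearIndependent ℝ ![x, y]) {a b c : ℝ}
    (h : a • vecMulVec x x + b • vecMulVec y y + c • (vecMulVec x y + vecMulVec y x) = 0) :
    a = 0 ∧ b = 0 ∧ c = 0 := by
  rw [LinearIndependent.pair_iff] at hxy
  have hrow : ∀ i, a * x i + c * y i = 0 ∧ c * x i + b * y i = 0 := fun i => by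
    refine hxy _ _ (funext fun j => ?_)
    have := congrFun (congrFun h i) j
    simp [vecMulVec_apply] at this ⊢
    linarith
  obtain ⟨ha, hc⟩ := hxy a c (funext fun i => by simpa using (hrow i).1)
  obtain ⟨-, hb⟩ := hxy c b (funext fun i => by simpa using (hrow i).2)
  exact ⟨ha, hb, hc⟩

lemma IsStdRel.isClosed {r : ℝ → ℝ → Prop} (hr : IsStdRel r) (d : ℝ) : IsClosed {s | r s d} := by
  rcases hr with rfl | rfl | rfl
  · exact isClosed_Iic
  · exact isClosed_singleton
  · exact isClosed_Ici

/-- A constraint that holds is kept by small perturbations, provided that the perturbation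
vanishes whenever the residual does. -/
lemma IsStdRel.eventually_add_mul {r : ℝ → ℝ → Prop} (hr : IsStdRel r) {s d e : ℝ} (h : r s d)
    (he : d - s = 0 → e = 0) : ∀ᶠ t : ℝ in nhds 0, r (s + t * e) d := by
  by_cases h0 : d - s = 0
  · simp [he h0, h]
  have ht : Filter.Tendsto (fun t : ℝ => s + t * e) (nhds 0) (nhds s) := by
    have : Continuous fun t : ℝ => s + t * e := by fun_prop
    simpa using this.tendsto 0
  have hne : d ≠ s := sub_ne_zero.mp h0
  rcases hr with rfl | rfl | rfl
  · exact (ht.eventually (gt_mem_nhds (lt_of_le_of_ne h hne.symm))).mono fun _ => le_of_lt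
  · exact absurd h hne.symm
  · exact (ht.eventually (lt_mem_nhds (lt_of_le_of_ne h hne))).mono fun _ => le_of_lt

/-- If `V` is a positive semidefinite family one of whose blocks dominates `x xᵀ + y yᵀ` with
`x`, `y` linearly independent, then any system of at most `#{q | V q ≠ 0} + 1` homogeneous linear
equations (those indexed by the complement of `R`) admits a nonzero solution `D` such that
`V + t D` is positive semidefinite for all small `t`. -/
lemma exists_ne_zero_eventually_posSemidef_add_smul {qhat m : ℕ} {nb : Fin qhat → ℕ}
    {V : (q : Fin qhat) → Matrix (Fin (nb q)) (Fin (nb q)) ℝ} (hV : ∀ q, (V q).PosSemidef)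
    {q₀ : Fin qhat} {x y : Fin (nb q₀) → ℝ} (hli : LinearIndependent ℝ ![x, y])
    (hxy : ∀ z, (x ⬝ᵥ z) ^ 2 + (y ⬝ᵥ z) ^ 2 ≤ z ⬝ᵥ (V q₀ *ᵥ z))
    (A : Fin m → (q : Fin qhat) → Matrix (Fin (nb q)) (Fin (nb q)) ℝ) (R : Set (Fin m))
    (hcard : m - 1 ≤ {q | V q ≠ 0}.ncard + R.ncard) :
    ∃ D : (q : Fin qhat) → Matrix (Fin (nb q)) (Fin (nb q)) ℝ, D ≠ 0 ∧
      (∀ k ∉ R, blockInner (A k) D = 0) ∧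
      ∀ᶠ t : ℝ in nhds 0, ∀ q, (V q + t • D q).PosSemidef := by
  classical
  let P := Function.update V q₀ (vecMulVec x x)
  let Y : (q : Fin qhat) → Matrix (Fin (nb q)) (Fin (nb q)) ℝ := Pi.single q₀ (vecMulVec y y)
  let Z : (q : Fin qhat) → Matrix (Fin (nb q)) (Fin (nb q)) ℝ :=
    Pi.single q₀ (vecMulVec x y + vecMulVec y x)
  let dir : ((Fin qhat → ℝ) × ℝ × ℝ) →ₗ[ℝ] (q : Fin qhat) → Matrix (Fin (nb q)) (Fin (nb q)) ℝ :=
    { toFun := fun e q => e.1 q • P q + e.2.1 • Y q + e.2.2 • Z q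
      map_add' := fun e f => by
        ext q : 1
        simp only [Prod.fst_add, Prod.snd_add, Pi.add_apply, add_smul]
        abel
      map_smul' := fun t e => by
        ext q : 1
        simp [mul_smul] }
  have hdir₀ : ∀ e, dir e q₀ = e.1 q₀ • vecMulVec x x + e.2.1 • vecMulVec y y +
      e.2.2 • (vecMulVec x y + vecMulVec y x) := fun e => by
    simp [dir, P, Y, Z]
  have hdir : ∀ e, ∀ q ≠ q₀, dir e q = e.1 q • V q := fun e q hq => by
    simp [dir, P, Y, Z, hq]
  let eqns : ((Fin qhat → ℝ) × ℝ × ℝ) →ₗ[ℝ]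
      ({k : Fin m // k ∉ R} → ℝ) × ({q : Fin qhat // V q = 0} → ℝ) :=
    { toFun := fun e => (fun k => blockInner (A k) (dir e), fun q => e.1 q)
      map_add' := fun e f => by
        ext <;> simp [blockInner_add]
      map_smul' := fun t e => by
        ext <;> simp [blockInner_smul] }
  have hker : LinearMap.ker eqns ≠ ⊥ := by
    refine LinearMap.ker_ne_bot_of_finrank_lt ?_
    have h1 : Fintype.card {k : Fin m // k ∉ R} + R.ncard = m := by
      rw [← Nat.card_eq_fintype_card, add_comm]
      exact (Set.ncard_add_ncard_compl R).trans (Nat.card_fin m)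
    have h2 : Fintype.card {q : Fin qhat // V q = 0} + {q | V q ≠ 0}.ncard = qhat := by
      rw [← Nat.card_eq_fintype_card]
      exact (Set.ncard_add_ncard_compl {q | V q = 0}).trans (Nat.card_fin qhat)
    simp only [Module.finrank_prod, Module.finrank_fintype_fun_eq_card, Module.finrank_self,
      Fintype.card_fin]
    omega
  obtain ⟨e, he, hne⟩ := (Submodule.ne_bot_iff _).mp hker
  have he' : (fun k : {k : Fin m // k ∉ R} => blockInner (A k) (dir e),
      fun q : {q : Fin qhat // V q = 0} => e.1 q) = 0 := he
  rw [Prod.mk_eq_zero] at he'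
  refine ⟨dir e, fun h0 => hne ?_, fun k hk => congrFun he'.1 ⟨k, hk⟩, ?_⟩
  · obtain ⟨ha, hb, hc⟩ := eq_zero_of_smul_vecMulVec_add_eq_zero hli
      ((hdir₀ e).symm.trans (congrFun h0 q₀))
    refine Prod.ext (funext fun q => ?_) (Prod.ext hb hc)
    by_cases hq : q = q₀
    · rw [hq]
      exact ha
    by_cases hVq : V q = 0
    · exact congrFun he'.2 ⟨q, hVq⟩
    · exact (smul_eq_zero.mp ((hdir e q hq).symm.trans (congrFun h0 q))).resolve_right hVq
  · refine Filter.eventually_all.mpr fun q => ?_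
    by_cases hq : q = q₀
    · subst hq
      rw [hdir₀]
      exact (hV q).eventually_add_smul hxy _ _ _
    · have hlim : Filter.Tendsto (fun t : ℝ => 1 + t * e.1 q) (nhds 0) (nhds 1) := by
        have : Continuous fun t : ℝ => 1 + t * e.1 q := by fun_prop
        simpa using this.tendsto 0
      filter_upwards [hlim.eventually (lt_mem_nhds one_pos)] with t ht
      have hsum : V q + t • dir e q = (1 + t * e.1 q) • V q := by
        rw [hdir e q hq, smul_smul, add_smul, one_smul]
      rw [hsum]
      exact (hV q).smul ht.le

section Optimality

variable {qhat m : ℕ} {nb : Fin qhat → ℕ}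
  {C : (q : Fin qhat) → Fin (m + 1) → Matrix (Fin (nb q)) (Fin (nb q)) ℝ}
  {rel : Fin m → ℝ → ℝ → Prop} {δ : Fin m → ℝ}

lemma homSDPROpt_iff {V : (q : Fin qhat) → Matrix (Fin (nb q)) (Fin (nb q)) ℝ} :
    homSDPROpt qhat m nb C rel δ V ↔ homSDPRFeas qhat m nb C rel δ V ∧
      ∀ W, homSDPRFeas qhat m nb C rel δ W →
        blockInner (fun q => C q 0) V ≤ blockInner (fun q => C q 0) W := by
  refine and_congr_right fun hV => ⟨fun h W hW => ?_, fun h => le_antisymm ?_ ?_⟩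
  · rw [← EReal.coe_le_coe_iff]
    exact h.le.trans (sInf_le ⟨W, hW, rfl⟩)
  · refine le_sInf ?_
    rintro _ ⟨W, hW, rfl⟩
    exact EReal.coe_le_coe_iff.mpr (h W hW)
  · exact sInf_le ⟨V, hV, rfl⟩

lemma homSDPRFeas_vecMulVec_iff {v : (q : Fin qhat) → Fin (nb q) → ℝ} :
    homSDPRFeas qhat m nb C rel δ (fun q => vecMulVec (v q) (v q)) ↔
      homQCQPFeas qhat m nb C rel δ v := by
  simp only [homSDPRFeas, homQCQPFeas, mInner_vecMulVec, and_iff_right_iff_imp]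
  exact fun _ q => posSemidef_vecMulVec_self_star (v q)

lemma isClosed_setOf_homSDPROpt (hrel : ∀ k, IsStdRel (rel k)) :
    IsClosed {V | homSDPROpt qhat m nb C rel δ V} := by
  simp only [homSDPROpt_iff, homSDPRFeas, Set.ofPred_and, Set.ofPred_forall]
  refine IsClosed.inter (IsClosed.inter ?_ (isClosed_iInter fun k => ?_))
    (isClosed_iInter fun W => isClosed_iInter fun _ =>
      isClosed_le (continuous_blockInner _) continuous_const)
  · simpa only [Set.ofPred_forall] using isClosed_setOf_forall_posSemidef (nb := nb)
  · exact ((hrel k).isClosed (δ k)).preimage (continuous_blockInner fun q => C q k.succ)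

/-- A direction that keeps optimal solutions positive semidefinite and respects the active
constraints stays inside the optimal set for a short while, both forwards and backwards. -/
lemma homSDPROpt.exists_pos_add_sub_smul (hrel : ∀ k, IsStdRel (rel k))
    {V D : (q : Fin qhat) → Matrix (Fin (nb q)) (Fin (nb q)) ℝ}
    (hV : homSDPROpt qhat m nb C rel δ V)
    (hD : ∀ k, δ k - ∑ q, mInner (C q k.succ) (V q) = 0 →
      blockInner (fun q => C q k.succ) D = 0)
    (hpsd : ∀ᶠ t : ℝ in nhds 0, ∀ q, (V q + t • D q).PosSemidef) :
    ∃ t : ℝ, 0 < t ∧ homSDPROpt qhat m nb C rel δ (V + t • D) ∧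
      homSDPROpt qhat m nb C rel δ (V - t • D) := by
  have hfeas : ∀ᶠ t : ℝ in nhds 0, homSDPRFeas qhat m nb C rel δ (V + t • D) := by
    refine hpsd.and (Filter.eventually_all.mpr fun k => ?_)
    filter_upwards [(hrel k).eventually_add_mul (hV.1.2 k) (hD k)] with t ht
    change rel k (blockInner (fun q => C q k.succ) (V + t • D)) (δ k)
    rwa [blockInner_add, blockInner_smul]
  obtain ⟨ε, hε, h⟩ := Metric.eventually_nhds_iff.mp hfeas
  have hmem : ∀ s : ℝ, |s| = ε / 2 → homSDPRFeas qhat m nb C rel δ (V + s • D) := fun s hs =>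
    h (by rw [Real.dist_eq, sub_zero, hs]; linarith)
  have hp := hmem (ε / 2) (abs_of_pos (by positivity))
  have hm := hmem (-(ε / 2)) (by rw [abs_neg, abs_of_pos (by positivity)])
  obtain ⟨-, hopt⟩ := homSDPROpt_iff.mp hV
  have h1 := hopt _ hp
  have h2 := hopt _ hm
  rw [blockInner_add, blockInner_smul] at h1 h2
  refine ⟨ε / 2, by positivity, homSDPROpt_iff.mpr ⟨hp, fun W hW => ?_⟩, ?_⟩
  · rw [blockInner_add, blockInner_smul]
    linarith [hopt W hW]
  · rw [sub_eq_add_neg, ← neg_smul]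
    refine homSDPROpt_iff.mpr ⟨hm, fun W hW => ?_⟩
    rw [blockInner_add, blockInner_smul]
    linarith [hopt W hW]

end Optimality

/-- **Theorem 4.5.** If (A) at every optimal solution of SDPR(δ) at least `m−1` of the
matrices `V^q` and the residuals `δₖ − Σ_q ⟨Cᵠₖ, V^q⟩` are nonzero, and (B) SDPR(δ) has
an optimal solution, then SDPR(δ) admits an optimal solution with all blocks of rank at
most one; its factors give an optimal solution of the QCQP, and the SDPR is exact. -/
theorem homogeneous_rank_one_optimal
    (qhat m : ℕ) (hqhat : 0 < qhat) (hm : 0 < m)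
    (nb : Fin qhat → ℕ)
    (C : (q : Fin qhat) → Fin (m + 1) → Matrix (Fin (nb q)) (Fin (nb q)) ℝ)
    (hCsymm : ∀ q k, (C q k).IsSymm)
    (rel : Fin m → ℝ → ℝ → Prop) (hrel : ∀ k, IsStdRel (rel k))
    (δ : Fin m → ℝ)
    (hA : ∀ V : (q : Fin qhat) → Matrix (Fin (nb q)) (Fin (nb q)) ℝ,
      homSDPROpt qhat m nb C rel δ V →
      m - 1 ≤ {q : Fin qhat | V q ≠ 0}.ncard +
        {k : Fin m | δ k - ∑ q, mInner (C q k.succ) (V q) ≠ 0}.ncard)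
    (hB : ∃ V : (q : Fin qhat) → Matrix (Fin (nb q)) (Fin (nb q)) ℝ,
      homSDPROpt qhat m nb C rel δ V) :
    ∃ Vt : (q : Fin qhat) → Matrix (Fin (nb q)) (Fin (nb q)) ℝ,
      homSDPROpt qhat m nb C rel δ Vt ∧
      (∀ q, (Vt q).rank ≤ 1) ∧
      ∃ vb : (q : Fin qhat) → Fin (nb q) → ℝ,
        (∀ q, Vt q = vecMulVec (vb q) (vb q)) ∧
        homQCQPFeas qhat m nb C rel δ vb ∧
        ((∑ q, vb q ⬝ᵥ (C q 0 *ᵥ vb q) : ℝ) : EReal) = homQCQPVal qhat m nb C rel δ ∧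
        homSDPRVal qhat m nb C rel δ = homQCQPVal qhat m nb C rel δ := by
  obtain ⟨V, hV, hext⟩ := exists_mem_forall_add_sub_mem_eq_zero
    (isClosed_setOf_homSDPROpt (C := C) (δ := δ) hrel) (fun X hX => hX.1.1) hB
  have hrank : ∀ q, ∃ b, V q = vecMulVec b b := fun q => by
    refine (hV.1.1 q).eq_vecMulVec_or_exists_linearIndependent.resolve_right ?_
    rintro ⟨x, y, hli, hxy⟩
    obtain ⟨D, hD0, hD, hpsd⟩ := exists_ne_zero_eventually_posSemidef_add_smul hV.1.1 hli hxy
      (fun k q => C q k.succ) _ (hA V hV)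
    obtain ⟨t, ht, hp, hm⟩ := hV.exists_pos_add_sub_smul hrel
      (fun k hk => hD k (not_not.mpr hk)) hpsd
    exact hD0 ((smul_eq_zero.mp (hext (t • D) hp hm)).resolve_left ht.ne')
  choose v hv using hrank
  obtain rfl : V = fun q => vecMulVec (v q) (v q) := funext hv
  have hfeas := homSDPRFeas_vecMulVec_iff.mp hV.1
  have hval : ((∑ q, v q ⬝ᵥ (C q 0 *ᵥ v q) : ℝ) : EReal) = homSDPRVal qhat m nb C rel δ := by
    simpa only [mInner_vecMulVec] using hV.2
  have hle : homSDPRVal qhat m nb C rel δ ≤ homQCQPVal qhat m nb C rel δ := by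
    refine le_sInf ?_
    rintro _ ⟨w, hw, rfl⟩
    exact sInf_le ⟨_, homSDPRFeas_vecMulVec_iff.mpr hw, by simp only [mInner_vecMulVec]⟩
  have hge : homQCQPVal qhat m nb C rel δ ≤ ((∑ q, v q ⬝ᵥ (C q 0 *ᵥ v q) : ℝ) : EReal) :=
    sInf_le ⟨v, hfeas, rfl⟩
  have heq : homSDPRVal qhat m nb C rel δ = homQCQPVal qhat m nb C rel δ :=
    hle.antisymm (hge.trans hval.le)
  exact ⟨_, hV, fun q => rank_vecMulVec_le _ _, v, fun _ => rfl, hfeas, hval.trans heq, heq⟩
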